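/- arXiv:2507.20584 — 2 statements merged into one kernel-verified Lean document; each statement's English description precedes it below -/
import Mathlib

section
/- For every natural number n, if n is odd and n is not congruent to 1 modulo 3, then the n-th Catalan number C_n is divisible by n + 2. -/
theorem add_two_mul_catalan_succ (n : ℕ) :
    (n + 2) * catalan (n + 1) = 2 * (2 * n + 1) * catalan n := by
  have h := n.succ_mul_centralBinom_succ
  rw [← succ_mul_catalan_eq_centralBinom, ← succ_mul_catalan_eq_centralBinom] at h
  apply Nat.eq_of_mul_eq_mul_left (Nat.add_pos_right n one_pos)
  linear_combination h

theorem coprime_add_two_two_mul_two_mul_add_one {n : ℕ} (h1 : Odd n) (h2 : n % 3 ≠ 1) :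
    Nat.Coprime (n + 2) (2 * (2 * n + 1)) := by
  refine Nat.Coprime.mul_right (Nat.coprime_two_right.2 (h1.add_even even_two)) ?_
  have h3 : Nat.Coprime (n + 2) 3 :=
    ((Nat.Prime.coprime_iff_not_dvd Nat.prime_three).2 (by lia)).symm
  refine Nat.Coprime.eq_one_of_dvd (h3.coprime_dvd_left (Nat.gcd_dvd_left _ (2 * n + 1))) ?_
  have h := Nat.dvd_sub ((Nat.gcd_dvd_left (n + 2) (2 * n + 1)).mul_left 2)
    (Nat.gcd_dvd_right (n + 2) (2 * n + 1))
  rwa [show 2 * (n + 2) - (2 * n + 1) = 3 by lia] at h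

theorem catalan_div (n : ℕ) (h1 : Odd n) (h2 : n % 3 ≠ 1) :
    (n + 2) ∣ catalan n :=
  (coprime_add_two_two_mul_two_mul_add_one h1 h2).dvd_of_dvd_mul_left
    ⟨_, (add_two_mul_catalan_succ n).symm⟩
end

section
/- For every natural number n, if n is odd and n is not congruent to 1 modulo 3, then (n+1)*(n+2) divides the central binomial coefficient binom(2n, n). -/
theorem coprime_add_two_two_mul_add_one {n : ℕ} (h : n % 3 ≠ 1) :
    Nat.Coprime (n + 2) (2 * n + 1) := by
  refine Nat.coprime_of_dvd fun p hp hn hm => ?_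
  have h3 : p ∣ 3 := by
    have := Nat.dvd_sub (hn.mul_left 2) hm
    rwa [show 2 * (n + 2) - (2 * n + 1) = 3 by omega] at this
  rw [(Nat.prime_dvd_prime_iff_eq hp Nat.prime_three).mp h3] at hn
  omega

theorem central_binom_div (n : ℕ) (h1 : Odd n) (h2 : n % 3 ≠ 1) :
    (n + 1) * (n + 2) ∣ Nat.choose (2 * n) n := by
  rw [← Nat.centralBinom_eq_two_mul_choose, ← succ_mul_catalan_eq_centralBinom]
  refine mul_dvd_mul_left _ ?_
  have h_two : Nat.Coprime (n + 2) 2 :=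
    Nat.coprime_two_right.mpr (h1.add_even even_two)
  exact (h_two.mul_right (coprime_add_two_two_mul_add_one h2)).dvd_of_dvd_mul_left
    (Dvd.intro _ (add_two_mul_catalan_succ n))
end
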